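/- Let v be a term of T₁^∘ of size p (number of variable occurrences). Then for every β ∈ B_•: v(1) · ∂β = ∂^p(β) · v(1). -/

import Mathlib

namespace ParenBraid

/-- Generators of the parenthesized braid group: `Sum.inl i` stands for `σ_{i+1}` and
`Sum.inr i` stands for `a_{i+1}` (so the index `i : ℕ` ranges over `0, 1, 2, …`,
representing the indices `1, 2, 3, …` of the paper). -/
abbrev Gen : Type := ℕ ⊕ ℕ

/-- The free-group generator `σ_{i+1}`. -/
def sg (i : ℕ) : FreeGroup Gen := FreeGroup.of (Sum.inl i)

/-- The free-group generator `a_{i+1}`. -/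
def ag (i : ℕ) : FreeGroup Gen := FreeGroup.of (Sum.inr i)

/-- The defining relations of the parenthesized braid group `B_•`, written as words
`lhs * rhs⁻¹`:  `σ_jσ_i = σ_iσ_j` and `a_jσ_i = σ_i a_j` for `j ≥ i+2`;
`a_jσ_i = σ_{i+1} a_j` and `a_j a_i = a_{i+1} a_j` for `j ≤ i−1`; and
`σ_{i+1}σ_iσ_{i+1} = σ_iσ_{i+1}σ_i`, `σ_iσ_{i+1} a_i = a_{i+1}σ_i`,
`σ_{i+1}σ_i a_{i+1} = a_iσ_i` for all `i ≥ 1`. -/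
def rels : Set (FreeGroup Gen) :=
  {r | (∃ i j : ℕ, j ≥ i + 2 ∧ r = sg j * sg i * (sg i * sg j)⁻¹) ∨
       (∃ i j : ℕ, j ≥ i + 2 ∧ r = ag j * sg i * (sg i * ag j)⁻¹) ∨
       (∃ i j : ℕ, j < i ∧ r = ag j * sg i * (sg (i + 1) * ag j)⁻¹) ∨
       (∃ i j : ℕ, j < i ∧ r = ag j * ag i * (ag (i + 1) * ag j)⁻¹) ∨
       (∃ i : ℕ, r = sg (i + 1) * sg i * sg (i + 1) * (sg i * sg (i + 1) * sg i)⁻¹) ∨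
       (∃ i : ℕ, r = sg i * sg (i + 1) * ag i * (ag (i + 1) * sg i)⁻¹) ∨
       (∃ i : ℕ, r = sg (i + 1) * sg i * ag (i + 1) * (ag i * sg i)⁻¹)}

/-- The parenthesized braid group `B_•`. -/
def Bdot : Type := PresentedGroup rels

instance : Group Bdot := by unfold Bdot; infer_instance

/-- The generator `σ_{i+1}` of `B_•`. -/
def σ (i : ℕ) : Bdot := PresentedGroup.of (Sum.inl i)

/-- The generator `a_{i+1}` of `B_•`. -/
def a (i : ℕ) : Bdot := PresentedGroup.of (Sum.inr i)


/-- Terms in a single variable over the single operation symbol `∘`. -/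
inductive CTerm : Type
  | var : CTerm
  | circ : CTerm → CTerm → CTerm

/-- The size of a `∘`-term: its number of variable occurrences. -/
def CTerm.size : CTerm → ℕ
  | .var => 1
  | .circ u v => u.size + v.size

/-- The evaluation `v(1)` of a `∘`-term `v` in `(B_•, ∘)`, with every variable
occurrence assigned the identity `1`, where `β ∘ γ := β·∂γ·a₁`. -/
def evalC (D : Bdot →* Bdot) : CTerm → Bdot
  | .var => 1
  | .circ u v => evalC D u * D (evalC D v) * a 0

theorem a_mul_σ_of_lt {i j : ℕ} (h : j < i) : a j * σ i = σ (i + 1) * a j :=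
  mul_inv_eq_one.mp <| PresentedGroup.one_of_mem (rels := rels)
    (x := ag j * sg i * (sg (i + 1) * ag j)⁻¹)
    (Or.inr (Or.inr (Or.inl ⟨i, j, h, rfl⟩)))

theorem a_mul_a_of_lt {i j : ℕ} (h : j < i) : a j * a i = a (i + 1) * a j :=
  mul_inv_eq_one.mp <| PresentedGroup.one_of_mem (rels := rels)
    (x := ag j * ag i * (ag (i + 1) * ag j)⁻¹)
    (Or.inr (Or.inr (Or.inr (Or.inl ⟨i, j, h, rfl⟩))))

/-- Conjugation by the first generator `a` acts as the shift on the image of the shift. -/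
theorem a_zero_mul_shift (D : Bdot →* Bdot)
    (hDσ : ∀ i : ℕ, D (σ i) = σ (i + 1)) (hDa : ∀ i : ℕ, D (a i) = a (i + 1)) (β : Bdot) :
    a 0 * D β = D (D β) * a 0 := by
  have h : (MulAut.conj (a 0)).toMonoidHom.comp D = D.comp D := by
    refine PresentedGroup.ext (rels := rels) fun x => ?_
    rcases x with i | i
    · change a 0 * D (σ i) * (a 0)⁻¹ = D (D (σ i))
      rw [hDσ, hDσ, a_mul_σ_of_lt i.succ_pos, mul_inv_cancel_right]
    · change a 0 * D (a i) * (a 0)⁻¹ = D (D (a i))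
      rw [hDa, hDa, a_mul_a_of_lt i.succ_pos, mul_inv_cancel_right]
  exact mul_inv_eq_iff_eq_mul.mp (DFunLike.congr_fun h β)

/-- if `v` is a `∘`-term of size `p`, then `v(1)·∂β = ∂^p(β)·v(1)`
for every `β ∈ B_•`. -/
theorem evalC_mul_shift (D : Bdot →* Bdot)
    (hDσ : ∀ i : ℕ, D (σ i) = σ (i + 1)) (hDa : ∀ i : ℕ, D (a i) = a (i + 1))
    (v : CTerm) (β : Bdot) :
    evalC D v * D β = (⇑D)^[v.size] β * evalC D v := by
  induction v generalizing β with
  | var => simp [evalC, CTerm.size]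
  | circ u v ihu ihv =>
    calc evalC D u * D (evalC D v) * a 0 * D β
        = evalC D u * D (evalC D v * D β) * a 0 := by
          rw [mul_assoc, a_zero_mul_shift D hDσ hDa, map_mul]
          simp only [mul_assoc]
      _ = evalC D u * D ((⇑D)^[v.size] β) * (D (evalC D v) * a 0) := by
          rw [ihv, map_mul]
          simp only [mul_assoc]
      _ = (⇑D)^[u.size + v.size] β * (evalC D u * D (evalC D v) * a 0) := by
          rw [ihu, Function.iterate_add_apply]
          simp only [mul_assoc]

end ParenBraid
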